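/- ω₁ ≤ add(v⁰) ≤ cov(v⁰) ≤ min{cf(𝔠), r}: the additivity of the ideal of v⁰-sets is uncountable, it is at most the covering number of (v⁰), and the covering number of (v⁰) is at most the cofinality of the continuum and at most the reaping number r. -/

import Mathlib

open Set

/-- `A`, `B` form a segment when `A ⊆ B` and `B \ A` is infinite. -/
def IsSeg (A B : Set ℕ) : Prop := A ⊆ B ∧ (B \ A).Infinite

/-- The segment `⟨A,B⟩ = {X ∈ [ω]^ω : A ⊆ X ⊆ B}`. -/
def Seg (A B : Set ℕ) : Set (Set ℕ) := {X | X.Infinite ∧ A ⊆ X ∧ X ⊆ B}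

/-- `X ⊆* Y` : the set `X \ Y` is finite. -/
def AlmostSub (X Y : Set ℕ) : Prop := (X \ Y).Finite

/-- The *-segment `⟨A,B⟩* = {X ∈ [ω]^ω : A ⊆* X ⊆* B}`. -/
def StarSeg (A B : Set ℕ) : Set (Set ℕ) := {X | X.Infinite ∧ AlmostSub A X ∧ AlmostSub X B}

/-- `S` is a v⁰-set: every segment contains a segment disjoint from `S`. -/
def IsVZero (S : Set (Set ℕ)) : Prop :=
  ∀ A B, IsSeg A B → ∃ C D, IsSeg C D ∧ Seg C D ⊆ Seg A B ∧ Seg C D ∩ S = ∅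

/-- `S` is a v-set: every segment contains a segment inside `S` or disjoint from `S`. -/
def IsVSet (S : Set (Set ℕ)) : Prop :=
  ∀ A B, IsSeg A B → ∃ C D, IsSeg C D ∧ Seg C D ⊆ Seg A B ∧
    (Seg C D ⊆ S ∨ Seg C D ∩ S = ∅)

/-- `add(v⁰)`: the additivity number of the ideal of v⁰-sets. -/
noncomputable def addV0 : Cardinal :=
  sInf {c : Cardinal | ∃ F : Set (Set (Set ℕ)),
    (∀ S ∈ F, IsVZero S) ∧ ¬ IsVZero (⋃₀ F) ∧ Cardinal.mk ↥F = c}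

/-- `cov(v⁰)`: the covering number of the ideal of v⁰-sets. -/
noncomputable def covV0 : Cardinal :=
  sInf {c : Cardinal | ∃ F : Set (Set (Set ℕ)),
    (∀ S ∈ F, IsVZero S) ∧ ⋃₀ F = {X : Set ℕ | X.Infinite} ∧ Cardinal.mk ↥F = c}

/-- `X` splits `A`: both `A ∩ X` and `A \ X` are infinite. -/
def Splits (X A : Set ℕ) : Prop := (A ∩ X).Infinite ∧ (A \ X).Infinite

/-- The reaping number `r`: the least cardinality of a family of infinite subsets of `ℕ`
not split by any single set. -/
noncomputable def rNum : Cardinal :=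
  sInf {c : Cardinal | ∃ R : Set (Set ℕ), (∀ A ∈ R, A.Infinite) ∧
    (∀ X : Set ℕ, ∃ A ∈ R, ¬ Splits X A) ∧ Cardinal.mk ↥R = c}

/-- A segment is contained in another only if its endpoints lie between those of the other. -/
theorem IsSeg.bounds_of_seg_subset {A B C D : Set ℕ} (h : IsSeg C D) (hs : Seg C D ⊆ Seg A B) :
    A ⊆ C ∧ D ⊆ B := by
  have hD : D.Infinite := h.2.mono sdiff_subset
  refine ⟨fun x hx => ?_, (hs ⟨hD, h.1, Subset.rfl⟩).2.2⟩
  by_contra hxC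
  have hX : D \ {x} ∈ Seg C D :=
    ⟨hD.sdiff (finite_singleton x), fun y hy => ⟨h.1 hy, fun e => hxC (e ▸ hy)⟩, sdiff_subset⟩
  exact ((hs hX).2.1 hx).2 rfl

theorem Seg.mono {A B C D : Set ℕ} (hA : A ⊆ C) (hB : D ⊆ B) : Seg C D ⊆ Seg A B :=
  fun _ hX => ⟨hX.1, hA.trans hX.2.1, hX.2.2.trans hB⟩

theorem IsSeg.nonempty_seg {A B : Set ℕ} (h : IsSeg A B) : (Seg A B).Nonempty :=
  ⟨B, h.2.mono sdiff_subset, h.1, Subset.rfl⟩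

/-- For finitely many finite modifications `t`, a segment can be shrunk so that no element
modified by any `t` lies in the v⁰-set. -/
theorem IsVZero.exists_seg_forall_union {S : Set (Set ℕ)} (hS : IsVZero S)
    (T : Finset (Finset ℕ)) {A B : Set ℕ} (h : IsSeg A B) (hT : ∀ t ∈ T, Disjoint (t : Set ℕ) B) :
    ∃ C D, IsSeg C D ∧ A ⊆ C ∧ D ⊆ B ∧ ∀ t ∈ T, ∀ X ∈ Seg C D, X ∪ ↑t ∉ S := by
  induction T using Finset.induction_on generalizing A B with
  | empty => exact ⟨A, B, h, Subset.rfl, Subset.rfl, by simp⟩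
  | insert t T _ ih =>
    obtain ⟨C, D, hCD, hAC, hDB, hX⟩ := ih h fun s hs => hT s (Finset.mem_insert_of_mem hs)
    have ht : Disjoint (t : Set ℕ) B := hT t (Finset.mem_insert_self _ _)
    have htD : Disjoint (t : Set ℕ) D := ht.mono_right hDB
    have hseg : IsSeg (C ∪ ↑t) (D ∪ ↑t) := by
      refine ⟨union_subset_union_left _ hCD.1, hCD.2.mono ?_⟩
      rintro x ⟨hxD, hxC⟩
      exact ⟨.inl hxD, fun hx => hx.elim hxC fun hxt => htD.ne_of_mem hxt hxD rfl⟩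
    obtain ⟨C', D', hCD', hsub, hdisj⟩ := hS _ _ hseg
    obtain ⟨hC', hD'⟩ := hCD'.bounds_of_seg_subset hsub
    have hCC' : C ⊆ C' \ ↑t := fun x hx =>
      ⟨hC' (.inl hx), fun hxt => htD.ne_of_mem hxt (hCD.1 hx) rfl⟩
    have hDD' : D' \ ↑t ⊆ D := fun x hx => (hD' hx.1).resolve_right hx.2
    refine ⟨C' \ ↑t, D' \ ↑t, ⟨sdiff_subset_sdiff_left hCD'.1, ?_⟩, hAC.trans hCC',
      hDD'.trans hDB, ?_⟩
    · refine (hCD'.2.sdiff t.finite_toSet).mono ?_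
      rintro x ⟨⟨h1, h2⟩, h3⟩
      exact ⟨⟨h1, h3⟩, fun h4 => h2 h4.1⟩
    · intro s hs X hXs
      rcases Finset.mem_insert.1 hs with rfl | hs
      · intro hmem
        have : X ∪ ↑s ∈ Seg C' D' ∩ S := by
          refine ⟨⟨hXs.1.mono subset_union_left, fun x hx => ?_, union_subset
            (hXs.2.2.trans sdiff_subset) ?_⟩, hmem⟩
          · by_cases hxs : x ∈ (s : Set ℕ)
            · exact .inr hxs
            · exact .inl (hXs.2.1 ⟨hx, hxs⟩)
          · exact (subset_union_right.trans hC').trans hCD'.1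
        rw [hdisj] at this
        exact this
      · exact hX s hs X (Seg.mono hCC' hDD' hXs)

/-- A segment can be shrunk to avoid a v⁰-set while keeping a given finite set of points free. -/
theorem IsVZero.exists_seg_of_finset {S : Set (Set ℕ)} (hS : IsVZero S) {A B : Set ℕ}
    (h : IsSeg A B) {F : Finset ℕ} (hF : ↑F ⊆ B \ A) :
    ∃ C D, IsSeg C D ∧ A ⊆ C ∧ D ⊆ B ∧ ↑F ⊆ D \ C ∧ Seg C D ∩ S = ∅ := by
  have hseg : IsSeg A (B \ ↑F) := by
    refine ⟨fun x hx => ⟨h.1 hx, fun hxF => (hF hxF).2 hx⟩,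
      (h.2.sdiff F.finite_toSet).mono ?_⟩
    rintro x ⟨⟨h1, h2⟩, h3⟩
    exact ⟨⟨h1, h3⟩, h2⟩
  obtain ⟨C, D, hCD, hAC, hDB, hX⟩ := hS.exists_seg_forall_union F.powerset hseg fun t ht =>
    disjoint_left.2 fun x hx hxB => hxB.2 (Finset.mem_powerset.1 ht hx)
  refine ⟨C, D ∪ ↑F, ⟨hCD.1.trans subset_union_left, hCD.2.mono
    (sdiff_subset_sdiff_left subset_union_left)⟩, hAC,
    union_subset (hDB.trans sdiff_subset) (hF.trans sdiff_subset),
    fun x hx => ⟨.inr hx, fun hxC => (hDB (hCD.1 hxC)).2 hx⟩, ?_⟩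
  classical
  refine eq_empty_of_forall_notMem ?_
  rintro X ⟨⟨hXi, hCX, hXD⟩, hXS⟩
  refine hX (F.filter (· ∈ X)) (Finset.mem_powerset.2 (Finset.filter_subset _ _)) (X \ ↑F)
    ⟨hXi.sdiff F.finite_toSet, fun x hx => ⟨hCX hx, fun hxF => (hDB (hCD.1 hx)).2 hxF⟩,
      fun x hx => (hXD hx.1).resolve_right hx.2⟩ ?_
  convert hXS
  ext x
  by_cases hx : x ∈ F <;> simp [hx]

/-- The v⁰-sets form a σ-ideal. -/
theorem IsVZero.iUnion_nat {S : ℕ → Set (Set ℕ)} (hS : ∀ n, IsVZero (S n)) :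
    IsVZero (⋃ n, S n) := by
  classical
  intro A B hAB
  let State := {p : Set ℕ × Set ℕ × Finset ℕ // IsSeg p.1 p.2.1 ∧ (p.2.2 : Set ℕ) ⊆ p.2.1 \ p.1}
  have step (n : ℕ) (p : State) : ∃ q : State, p.1.1 ⊆ q.1.1 ∧ q.1.2.1 ⊆ p.1.2.1 ∧
      p.1.2.2 ⊂ q.1.2.2 ∧ Seg q.1.1 q.1.2.1 ∩ S n = ∅ := by
    obtain ⟨⟨A, B, F⟩, h, hF⟩ := p
    obtain ⟨C, D, hCD, hAC, hDB, hFD, hdisj⟩ := (hS n).exists_seg_of_finset h hF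
    obtain ⟨a, ha, haF⟩ := hCD.2.exists_notMem_finset F
    refine ⟨⟨⟨C, D, insert a F⟩, hCD, ?_⟩, hAC, hDB, Finset.ssubset_insert haF, hdisj⟩
    rw [Finset.coe_insert]
    exact insert_subset ha hFD
  choose next h_lower h_upper h_free h_avoid using step
  let s : ℕ → State := fun n =>
    Nat.rec ⟨⟨A, B, ∅⟩, hAB, by simp⟩ (fun n p => next n p) n
  have hA : Monotone fun n => (s n).1.1 := monotone_nat_of_le_succ fun n => h_lower n (s n)
  have hB : Antitone fun n => (s n).1.2.1 := antitone_nat_of_succ_le fun n => h_upper n (s n)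
  have hF : StrictMono fun n => (s n).1.2.2 := strictMono_nat_of_lt_succ fun n => h_free n (s n)
  have hfree (n : ℕ) : ((s n).1.2.2 : Set ℕ) ⊆ (⋂ m, (s m).1.2.1) \ ⋃ m, (s m).1.1 := by
    have key (m : ℕ) : ((s n).1.2.2 : Set ℕ) ⊆ (s m).1.2.1 \ (s m).1.1 := by
      have h1 : ((s n).1.2.2 : Set ℕ) ⊆ ((s (max n m)).1.2.2 : Set ℕ) :=
        Finset.coe_subset.2 (hF.monotone (le_max_left n m))
      exact (h1.trans (s (max n m)).2.2).trans
        (sdiff_subset_sdiff (hB (le_max_right n m)) (hA (le_max_right n m)))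
    intro x hx
    exact ⟨mem_iInter.2 fun m => (key m hx).1, fun hx' =>
      let ⟨m, hm⟩ := mem_iUnion.1 hx'; (key m hx).2 hm⟩
  have hsub (n : ℕ) : Seg (⋃ m, (s m).1.1) (⋂ m, (s m).1.2.1) ⊆ Seg (s n).1.1 (s n).1.2.1 :=
    Seg.mono (subset_iUnion (fun m => (s m).1.1) n) (iInter_subset (fun m => (s m).1.2.1) n)
  refine ⟨⋃ m, (s m).1.1, ⋂ m, (s m).1.2.1, ⟨?_, ?_⟩, hsub 0, ?_⟩
  · refine iUnion_subset fun n => subset_iInter fun m => ?_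
    exact (hA (le_max_left n m)).trans
      ((s (max n m)).2.1.1.trans (hB (le_max_right n m)))
  · intro hfin
    have hle (n : ℕ) : (s n).1.2.2 ≤ hfin.toFinset := fun x hx => by
      simpa only [Finite.mem_toFinset] using hfree n hx
    have hinf : (range fun n => (s n).1.2.2).Infinite := infinite_range_of_injective hF.injective
    exact hinf ((finite_Iic hfin.toFinset).subset (range_subset_iff.2 hle))
  · refine eq_empty_of_forall_notMem ?_
    rintro X ⟨hX, hXS⟩
    obtain ⟨n, hn⟩ := mem_iUnion.1 hXS
    have : X ∈ Seg (s (n + 1)).1.1 (s (n + 1)).1.2.1 ∩ S n := ⟨hsub (n + 1) hX, hn⟩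
    rw [show Seg (s (n + 1)).1.1 (s (n + 1)).1.2.1 ∩ S n = ∅ from h_avoid n (s n)] at this
    exact this

theorem isVZero_empty : IsVZero ∅ :=
  fun A B h => ⟨A, B, h, Subset.rfl, inter_empty _⟩

theorem IsVZero.sUnion_of_countable {F : Set (Set (Set ℕ))} (hF : F.Countable)
    (h : ∀ S ∈ F, IsVZero S) : IsVZero (⋃₀ F) := by
  rcases F.eq_empty_or_nonempty with rfl | hne
  · simpa using isVZero_empty
  · obtain ⟨f, rfl⟩ := hF.exists_eq_range hne
    rw [sUnion_range]
    exact IsVZero.iUnion_nat fun n => h _ (mem_range_self n)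

theorem Set.Infinite.exists_infinite_union {α : Type*} {s : Set α} (h : s.Infinite) :
    ∃ t u : Set α, t ∪ u = s ∧ Disjoint t u ∧ t.Infinite ∧ u.Infinite := by
  obtain ⟨t, u, htu, hd, hc⟩ := h.exists_union_disjoint_cardinal_eq_of_infinite
  have hiff : t.Finite ↔ u.Finite := by
    rw [← Cardinal.lt_aleph0_iff_set_finite, hc, Cardinal.lt_aleph0_iff_set_finite]
  refine ⟨t, u, htu, hd, fun ht => ?_, fun hu => ?_⟩
  · exact h (htu ▸ ht.union (hiff.1 ht))
  · exact h (htu ▸ (hiff.2 hu).union hu)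

/-- Sets of cardinality less than the continuum are v⁰-sets. -/
theorem isVZero_of_mk_lt_continuum {S : Set (Set ℕ)} (hS : Cardinal.mk S < Cardinal.continuum) :
    IsVZero S := by
  intro A B hAB
  obtain ⟨P, E, hPE, hdisj, hP, hE⟩ := hAB.2.exists_infinite_union
  have hPA : Disjoint P A := disjoint_left.2 fun x hx hxA => (hPE.subset (.inl hx)).2 hxA
  have hEA : Disjoint E A := disjoint_left.2 fun x hx hxA => (hPE.subset (.inr hx)).2 hxA
  have hcard : Cardinal.mk (𝒫 P) = Cardinal.continuum := by
    have := hP.to_subtype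
    rw [Cardinal.mk_powerset, Cardinal.mk_eq_aleph0, Cardinal.two_power_aleph0]
  obtain ⟨Z, hZP, hZ⟩ : ∃ Z ∈ 𝒫 P, Z ∉ (fun X : Set ℕ => X ∩ P) '' S := by
    by_contra! hcon
    exact ((hcard ▸ Cardinal.mk_le_mk_of_subset hcon).trans Cardinal.mk_image_le).not_gt hS
  have hEC : Disjoint E (A ∪ Z) := hEA.union_right (hdisj.symm.mono_right hZP)
  refine ⟨A ∪ Z, A ∪ Z ∪ E, ⟨subset_union_left, hE.mono fun x hx =>
    ⟨.inr hx, fun hx' => hEC.ne_of_mem hx hx' rfl⟩⟩, Seg.mono subset_union_left ?_, ?_⟩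
  · refine union_subset (union_subset hAB.1 fun x hx => ?_) fun x hx => ?_
    · exact (hPE.subset (.inl (hZP hx))).1
    · exact (hPE.subset (.inr hx)).1
  · refine eq_empty_of_forall_notMem ?_
    rintro X ⟨⟨_, hl, hu⟩, hXS⟩
    refine hZ ⟨X, hXS, Subset.antisymm ?_ fun x hx => ⟨hl (.inr hx), hZP hx⟩⟩
    rintro x ⟨hx, hxP⟩
    rcases hu hx with (hxA | hxZ) | hxE
    · exact (hPA.ne_of_mem hxP hxA rfl).elim
    · exact hxZ
    · exact (hdisj.ne_of_mem hxP hxE rfl).elim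

theorem not_isVZero_setOf_infinite : ¬ IsVZero {X : Set ℕ | X.Infinite} := by
  intro h
  obtain ⟨C, D, hCD, -, hdisj⟩ := h ∅ univ ⟨empty_subset _, by simpa using infinite_univ⟩
  obtain ⟨X, hX⟩ := hCD.nonempty_seg
  exact eq_empty_iff_forall_notMem.1 hdisj X ⟨hX, hX.1⟩

theorem exists_isVZero_cover : ∃ F : Set (Set (Set ℕ)),
    (∀ S ∈ F, IsVZero S) ∧ ⋃₀ F = {X : Set ℕ | X.Infinite} := by
  refine ⟨(fun X => {X}) '' {X : Set ℕ | X.Infinite}, ?_, by ext; simp⟩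
  rintro _ ⟨X, -, rfl⟩
  refine isVZero_of_mk_lt_continuum ?_
  simpa using Cardinal.nat_lt_continuum 1

theorem addV0_le_covV0 : addV0 ≤ covV0 := by
  obtain ⟨F, hF, hU⟩ := exists_isVZero_cover
  refine csInf_le_csInf' ⟨_, F, hF, hU, rfl⟩ ?_
  rintro c ⟨F, hF, hU, rfl⟩
  exact ⟨F, hF, hU ▸ not_isVZero_setOf_infinite, rfl⟩

theorem aleph_one_le_addV0 : Cardinal.aleph 1 ≤ addV0 := by
  obtain ⟨F, hF, hU⟩ := exists_isVZero_cover
  refine le_csInf ⟨_, F, hF, hU ▸ not_isVZero_setOf_infinite, rfl⟩ ?_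
  rintro c ⟨F, hF, hU, rfl⟩
  rw [Cardinal.aleph_one_le_iff]
  by_contra! hle
  exact hU (IsVZero.sUnion_of_countable (Cardinal.le_aleph0_iff_set_countable.1 hle) hF)

theorem IsVZero.mono {S T : Set (Set ℕ)} (hT : IsVZero T) (h : S ⊆ T) : IsVZero S := by
  intro A B hAB
  obtain ⟨C, D, hCD, hsub, hdisj⟩ := hT A B hAB
  exact ⟨C, D, hCD, hsub, subset_empty_iff.1 (hdisj ▸ inter_subset_inter_right _ h)⟩

/-- A family of v⁰-sets indexed by `I` that covers all infinite sets bounds `cov(v⁰)` by `#I`. -/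
theorem covV0_le_mk_of_cover {ι : Type} {I : Set ι} (f : ι → Set (Set ℕ))
    (hf : ∀ i ∈ I, IsVZero (f i)) (hcov : ∀ X : Set ℕ, X.Infinite → ∃ i ∈ I, X ∈ f i) :
    covV0 ≤ Cardinal.mk I := by
  refine (csInf_le' (?_ : Cardinal.mk
    ((fun i => f i ∩ {X : Set ℕ | X.Infinite}) '' I) ∈ _)).trans Cardinal.mk_image_le
  refine ⟨_, ?_, ?_, rfl⟩
  · rintro _ ⟨i, hi, rfl⟩
    exact (hf i hi).mono inter_subset_left
  · ext X
    constructor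
    · rintro ⟨_, ⟨i, -, rfl⟩, hX⟩
      exact hX.2
    · intro hX
      obtain ⟨i, hi, hXi⟩ := hcov X hX
      exact ⟨_, ⟨i, hi, rfl⟩, hXi, hX⟩

theorem covV0_le_cof_continuum : covV0 ≤ Cardinal.continuum.ord.cof := by
  let W := Cardinal.continuum.{0}.ord.ToType
  have : NoMaxOrder W := Cardinal.noMaxOrder Cardinal.aleph0_le_continuum
  have hW : Cardinal.mk W = Cardinal.continuum := Cardinal.mk_ord_toType _
  obtain ⟨e⟩ : Nonempty (W ≃ Set ℕ) := Cardinal.eq.1 (hW.trans Cardinal.mk_set_nat.symm)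
  obtain ⟨I, hI, hIc⟩ := Order.exists_cof_eq W
  rw [← Ordinal.cof_toType, ← hIc]
  refine covV0_le_mk_of_cover (fun i => e '' Iic i) (fun i _ => isVZero_of_mk_lt_continuum ?_) ?_
  · obtain ⟨j, hj⟩ := exists_gt i
    calc Cardinal.mk (e '' Iic i) ≤ Cardinal.mk (Iic i) := Cardinal.mk_image_le
      _ ≤ Cardinal.mk (Iio j) := Cardinal.mk_le_mk_of_subset (Iic_subset_Iio.2 hj)
      _ < Cardinal.mk W := Cardinal.mk_Iio_lt j (by simp [W])
      _ = Cardinal.continuum := hW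
  · intro X _
    obtain ⟨i, hi, hle⟩ := hI (e.symm X)
    exact ⟨i, hi, e.symm X, hle, e.apply_symm_apply X⟩

/-- The set of `n` for which `X` has an even number of elements below `n`. -/
def evenCount (X : Set ℕ) : Set ℕ := {n | Even (X ∩ Iio n).ncard}

theorem mem_evenCount_iff_not_of_odd {X : Set ℕ} {a b : ℕ} (hab : a ≤ b)
    (h : Odd (X ∩ Ico a b).ncard) : b ∈ evenCount X ↔ a ∉ evenCount X := by
  have hsplit : (X ∩ Iio b).ncard = (X ∩ Iio a).ncard + (X ∩ Ico a b).ncard := by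
    rw [← ncard_union_eq _ ((finite_Iio a).inter_of_right X) ((finite_Ico a b).inter_of_right X),
      ← inter_union_distrib_left, Iio_union_Ico_eq_Iio hab]
    exact disjoint_left.2 fun x hx hx' => (hx.2.trans_le hx'.2.1).false
  simp only [evenCount, mem_ofPred_eq, hsplit, Nat.even_add]
  rw [← Nat.not_even_iff_odd] at h
  tauto

theorem splits_evenCount {X A : Set ℕ}
    (h : ∀ n, ∃ a ∈ A, ∃ b ∈ A, n ≤ a ∧ a ≤ b ∧ Odd (X ∩ Ico a b).ncard) :
    Splits (evenCount X) A := by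
  have key (n : ℕ) : (∃ x ∈ A ∩ evenCount X, n ≤ x) ∧ ∃ x ∈ A \ evenCount X, n ≤ x := by
    obtain ⟨a, ha, b, hb, hna, hab, hodd⟩ := h n
    have hiff := mem_evenCount_iff_not_of_odd hab hodd
    by_cases hmem : a ∈ evenCount X
    · exact ⟨⟨a, ⟨ha, hmem⟩, hna⟩, b, ⟨hb, fun hb' => hiff.1 hb' hmem⟩, hna.trans hab⟩
    · exact ⟨⟨b, ⟨hb, hiff.2 hmem⟩, hna.trans hab⟩, a, ⟨ha, hmem⟩, hna⟩
  constructor <;> refine infinite_of_forall_exists_gt fun n => ?_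
  · obtain ⟨x, hx, hn⟩ := (key (n + 1)).1
    exact ⟨x, hx, hn⟩
  · obtain ⟨x, hx, hn⟩ := (key (n + 1)).2
    exact ⟨x, hx, hn⟩

theorem isVZero_not_splits_evenCount {A : Set ℕ} (hA : A.Infinite) :
    IsVZero {X | ¬ Splits (evenCount X) A} := by
  classical
  intro P Q hPQ
  have hblock (k : ℕ) : ∃ d ∈ Q \ P, ∃ a ∈ A, ∃ m ∈ Q \ P, ∃ b ∈ A,
      k < d ∧ d < a ∧ a < m ∧ m < b := by
    obtain ⟨d, hd, hkd⟩ := hPQ.2.exists_gt k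
    obtain ⟨a, ha, hda⟩ := hA.exists_gt d
    obtain ⟨m, hm, ham⟩ := hPQ.2.exists_gt a
    obtain ⟨b, hb, hmb⟩ := hA.exists_gt m
    exact ⟨d, hd, a, ha, m, hm, b, hb, hkd, hda, ham, hmb⟩
  choose d hd a ha m hm b hb hkd hda ham hmb using hblock
  let k : ℕ → ℕ := fun n => b^[n] 0
  have hk (n : ℕ) : k (n + 1) = b (k n) := Function.iterate_succ_apply' b n 0
  have hkb (n : ℕ) : n < b n := by linarith [hkd n, hda n, ham n, hmb n]
  have hkmono : StrictMono k := strictMono_nat_of_lt_succ fun n => hk n ▸ hkb (k n)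
  -- Points lying in the blocks `i` and `j` can only interact if `i = j`.
  have hsep {i j : ℕ} (h1 : k i < b (k j)) (h2 : k j < b (k i)) : i = j := by
    rw [← hk, hkmono.lt_iff_lt] at h1 h2
    omega
  have hd_ne (i j : ℕ) (hmem : d (k i) ∈ Ico (a (k j)) (b (k j))) : False := by
    have := hkd (k i); have := hda (k i); have := ham (k i); have := hmb (k i)
    have := hkd (k j); have := hda (k j)
    obtain rfl := hsep (i := i) (j := j) (by linarith [hmem.2]) (by linarith [hmem.1])
    linarith [hmem.1]
  have hm_eq {i j : ℕ} (hmem : m (k i) ∈ Ico (a (k j)) (b (k j))) : i = j := by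
    have := hkd (k i); have := hda (k i); have := ham (k i); have := hmb (k i)
    have := hkd (k j); have := hda (k j)
    exact hsep (by linarith [hmem.2]) (by linarith [hmem.1])
  have hm_mem (j : ℕ) : m (k j) ∈ Ico (a (k j)) (b (k j)) := ⟨(ham _).le, hmb _⟩
  let E : Set ℕ := range fun n => d (k n)
  let M : Set ℕ := {x | ∃ n, x = m (k n) ∧ Even (P ∩ Ico (a (k n)) (b (k n))).ncard}
  have hEinf : E.Infinite := infinite_range_of_injective <| StrictMono.injective <|
    strictMono_nat_of_lt_succ fun n => by
      have := hk n; have := hda (k n); have := ham (k n); have := hmb (k n)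
      have := hkd (k (n + 1))
      omega
  have hEC : Disjoint E (P ∪ M) := by
    refine disjoint_left.2 ?_
    rintro _ ⟨n, rfl⟩ (hP | ⟨j, hj, -⟩)
    · exact (hd _).2 hP
    · exact hd_ne n j (by simpa only [hj] using hm_mem j)
  refine ⟨P ∪ M, P ∪ M ∪ E, ⟨subset_union_left, hEinf.mono fun x hx =>
    ⟨.inr hx, fun hx' => hEC.ne_of_mem hx hx' rfl⟩⟩, Seg.mono subset_union_left ?_, ?_⟩
  · refine union_subset (union_subset hPQ.1 ?_) ?_
    · rintro _ ⟨n, rfl, -⟩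
      exact (hm _).1
    · rintro _ ⟨n, rfl⟩
      exact (hd _).1
  · refine eq_empty_of_forall_notMem ?_
    rintro X ⟨⟨_, hl, hu⟩, hXS⟩
    refine hXS (splits_evenCount fun n => ⟨a (k n), ha _, b (k n), hb _, ?_, ?_, ?_⟩)
    · have := hkmono.le_apply (x := n); have := hkd (k n); have := hda (k n)
      linarith
    · exact ((ham _).trans (hmb _)).le
    · have hX : X ∩ Ico (a (k n)) (b (k n)) = (P ∪ M) ∩ Ico (a (k n)) (b (k n)) := by
        refine Subset.antisymm ?_ (inter_subset_inter_left _ hl)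
        rintro x ⟨hx, hxI⟩
        refine ⟨(hu hx).resolve_right ?_, hxI⟩
        rintro ⟨j, rfl⟩
        exact hd_ne j n hxI
      rw [hX]
      by_cases heven : Even (P ∩ Ico (a (k n)) (b (k n))).ncard
      · have : (P ∪ M) ∩ Ico (a (k n)) (b (k n)) =
            insert (m (k n)) (P ∩ Ico (a (k n)) (b (k n))) := by
          ext x
          constructor
          · rintro ⟨hx | ⟨j, rfl, -⟩, hxI⟩
            · exact .inr ⟨hx, hxI⟩
            · exact .inl (by rw [hm_eq hxI])
          · rintro (rfl | hx)
            · exact ⟨.inr ⟨n, rfl, heven⟩, hm_mem n⟩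
            · exact ⟨.inl hx.1, hx.2⟩
        rw [this, ncard_insert_of_notMem (fun h => (hm _).2 h.1)
          ((finite_Ico _ _).inter_of_right P)]
        exact heven.add_one
      · have : (P ∪ M) ∩ Ico (a (k n)) (b (k n)) = P ∩ Ico (a (k n)) (b (k n)) := by
          refine Subset.antisymm ?_ (inter_subset_inter_left _ subset_union_left)
          rintro x ⟨hx | ⟨j, rfl, hj⟩, hxI⟩
          · exact ⟨hx, hxI⟩
          · exact (heven (hm_eq hxI ▸ hj)).elim
        rw [this]
        exact Nat.not_even_iff_odd.1 heven

theorem exists_reaping_family : ∃ R : Set (Set ℕ), (∀ A ∈ R, A.Infinite) ∧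
    ∀ X : Set ℕ, ∃ A ∈ R, ¬ Splits X A := by
  refine ⟨{A | A.Infinite}, fun A hA => hA, fun X => ?_⟩
  by_cases hX : X.Infinite
  · exact ⟨X, hX, fun h => h.2 (by simp)⟩
  · exact ⟨univ, infinite_univ, fun h => hX (by simpa using h.1)⟩

theorem covV0_le_rNum : covV0 ≤ rNum := by
  obtain ⟨R, hR, hsplit⟩ := exists_reaping_family
  refine le_csInf ⟨_, R, hR, hsplit, rfl⟩ ?_
  rintro c ⟨R, hR, hsplit, rfl⟩
  exact covV0_le_mk_of_cover (fun A => {X | ¬ Splits (evenCount X) A})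
    (fun A hA => isVZero_not_splits_evenCount (hR A hA)) fun X _ => hsplit (evenCount X)

/-- Theorem 17: `ω₁ ≤ add(v⁰) ≤ cov(v⁰) ≤ min (cf 𝔠) r`. -/
theorem addV0_covV0_bounds :
    Cardinal.aleph 1 ≤ addV0 ∧ addV0 ≤ covV0 ∧
      covV0 ≤ min Cardinal.continuum.ord.cof rNum := by
  exact ⟨aleph_one_le_addV0, addV0_le_covV0, le_min covV0_le_cof_continuum covV0_le_rNum⟩
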